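/- Let X be a metric space, φ a flow on X, and (N,L) a weakly regular index pair for an isolated invariant set I. Then there exists a closed subset L' ⊆ N with L ⊆ L' such that (N, L') is a regular index pair for I, i.e. (N,L') is an index pair for I whose exit time map τ_+ : N → [0,∞] is continuous. -/

import Mathlib

open scoped ENNReal

/-- The exit time map `τ₊ : N → [0,∞]` of the pair `(N, L')`:
`τ₊(x) = sup {t ≥ 0 | φ^{[0,t]}(x) ⊆ N − L'}` for `x ∈ N − L'` and `τ₊(x) = 0` for `x ∈ L'`
(for `x ∈ L'` the set below is empty, so the supremum is `0`). -/
noncomputable def tauPlus {X : Type*} (φ : ℝ → X → X) (N L' : Set X) (x : N) : ℝ≥0∞ :=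
  sSup (ENNReal.ofReal '' {r : ℝ | 0 ≤ r ∧ ∀ s ∈ Set.Icc 0 r, φ s (x : X) ∈ N \ L'})

/-- The set of points `x` of `N` such that `f (φ s x) ≤ exp (-s) / 2` for every time `s ≥ 0` up to
which the orbit of `x` stays in `N`. -/
def dampedSublevel {X : Type*} (φ : ℝ → X → X) (N : Set X) (f : X → ℝ) : Set X :=
  {x ∈ N | ∀ s ≥ (0 : ℝ), (∀ r ∈ Set.Icc 0 s, φ r x ∈ N) → Real.exp s * f (φ s x) ≤ 1 / 2}

section IndexPair

variable {X : Type*} {φ : ℝ → X → X} {N L : Set X}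

theorem mem_of_forall_notMem_exit
    (hexit : ∀ x ∈ N, ¬ (∀ t ≥ (0 : ℝ), φ t x ∈ N) →
      ∃ t ≥ (0 : ℝ), (∀ s ∈ Set.Icc 0 t, φ s x ∈ N) ∧ φ t x ∈ L)
    {x : X} (hx : x ∈ N) {r : ℝ} (h : ∀ s ∈ Set.Icc 0 r, φ s x ∉ L) :
    ∀ s ∈ Set.Icc 0 r, φ s x ∈ N := by
  intro s hs
  by_contra hsN
  obtain ⟨t, ht, htN, htL⟩ := hexit x hx fun H => hsN (H s hs.1)
  rcases le_total t r with htr | htr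
  · exact h t ⟨ht, htr⟩ htL
  · exact hsN (htN s ⟨hs.1, hs.2.trans htr⟩)

theorem flow_mem_of_mem (hφadd : ∀ s t x, φ (s + t) x = φ s (φ t x))
    (hpos : ∀ x ∈ L, ∀ t ≥ (0 : ℝ), (∀ s ∈ Set.Icc 0 t, φ s x ∈ N) →
      ∀ s ∈ Set.Icc 0 t, φ s x ∈ L)
    {x : X} {r s : ℝ} (hr : 0 ≤ r) (hrs : r ≤ s) (hN : ∀ u ∈ Set.Icc 0 s, φ u x ∈ N)
    (hrL : φ r x ∈ L) : φ s x ∈ L := by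
  have h := hpos _ hrL (s - r) (sub_nonneg.2 hrs)
    (fun u hu => by
      rw [← hφadd]
      exact hN _ ⟨add_nonneg hu.1 hr, by linarith [hu.2]⟩)
    (s - r) ⟨sub_nonneg.2 hrs, le_rfl⟩
  rwa [← hφadd, sub_add_cancel] at h

theorem dampedSublevel_flow (hφadd : ∀ s t x, φ (s + t) x = φ s (φ t x)) {f : X → ℝ}
    {x : X} (hx : x ∈ dampedSublevel φ N f) {t : ℝ} (ht : 0 ≤ t)
    (hN : ∀ s ∈ Set.Icc 0 t, φ s x ∈ N) {s : ℝ} (hs : 0 ≤ s)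
    (hsN : ∀ r ∈ Set.Icc 0 s, φ r (φ t x) ∈ N) :
    Real.exp s * f (φ s (φ t x)) ≤ Real.exp (-t) * (1 / 2) := by
  have h := hx.2 (s + t) (add_nonneg hs ht) fun r hr => by
    rcases le_total r t with h | h
    · exact hN r ⟨hr.1, h⟩
    · have := hsN (r - t) ⟨sub_nonneg.2 h, by linarith [hr.2]⟩
      rwa [← hφadd, sub_add_cancel] at this
  rw [← hφadd]
  calc Real.exp s * f (φ (s + t) x)
      = Real.exp (-t) * (Real.exp (s + t) * f (φ (s + t) x)) := by
        rw [← mul_assoc, ← Real.exp_add]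
        ring_nf
    _ ≤ _ := mul_le_mul_of_nonneg_left h (Real.exp_pos _).le

theorem dampedSublevel_positivelyInvariant (hφadd : ∀ s t x, φ (s + t) x = φ s (φ t x))
    {f : X → ℝ} {x : X} (hx : x ∈ dampedSublevel φ N f) {t : ℝ}
    (hN : ∀ s ∈ Set.Icc 0 t, φ s x ∈ N) : ∀ s ∈ Set.Icc 0 t, φ s x ∈ dampedSublevel φ N f := by
  intro s hs
  refine ⟨hN s hs, fun u hu huN => ?_⟩
  have h := dampedSublevel_flow hφadd hx hs.1
    (fun r hr => hN r ⟨hr.1, hr.2.trans hs.2⟩) hu huN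
  have : Real.exp (-s) ≤ 1 := Real.exp_le_one_iff.2 (by linarith [hs.1])
  linarith

variable [TopologicalSpace X]

theorem eventually_forall_Icc_notMem (hφc : Continuous fun p : ℝ × X => φ p.1 p.2)
    (hL : IsClosed L) {x : X} {r : ℝ} (h : ∀ s ∈ Set.Icc 0 r, φ s x ∉ L) :
    ∀ᶠ y in nhds x, ∀ s ∈ Set.Icc 0 r, φ s y ∉ L := by
  refine isCompact_Icc.eventually_forall_of_forall_eventually fun s hs => ?_
  have hc : Continuous fun p : X × ℝ => φ p.2 p.1 := hφc.comp continuous_swap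
  exact (hL.isOpen_compl.preimage hc).mem_nhds (x := (x, s)) (h s hs)

theorem isClosed_setOf_forall_Icc_mem (hφc : Continuous fun p : ℝ × X => φ p.1 p.2)
    (hN : IsClosed N) :
    IsClosed {p : ℝ × X | 0 ≤ p.1 ∧ ∀ r ∈ Set.Icc 0 p.1, φ r p.2 ∈ N} := by
  have h : {p : ℝ × X | 0 ≤ p.1 ∧ ∀ r ∈ Set.Icc 0 p.1, φ r p.2 ∈ N} =
      {p : ℝ × X | 0 ≤ p.1} ∩ ⋂ u ∈ Set.Icc (0 : ℝ) 1, {p : ℝ × X | φ (u * p.1) p.2 ∈ N} := by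
    ext ⟨s, y⟩
    simp only [Set.mem_ofPred_eq, Set.mem_inter_iff, Set.mem_iInter]
    refine and_congr_right fun hs => ⟨fun H u hu => H _ ⟨mul_nonneg hu.1 hs, ?_⟩,
      fun H r hr => ?_⟩
    · exact mul_le_of_le_one_left hs hu.2
    · have h := H (r / s) ⟨div_nonneg hr.1 hs, div_le_one_of_le₀ hr.2 hs⟩
      rwa [div_mul_cancel_of_imp fun h0 => le_antisymm (h0 ▸ hr.2) hr.1] at h
  rw [h]
  refine (isClosed_le continuous_const continuous_fst).inter
    (isClosed_biInter fun u _ => hN.preimage ?_)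
  exact hφc.comp ((continuous_const.mul continuous_fst).prodMk continuous_snd)

theorem isClosed_dampedSublevel (hφc : Continuous fun p : ℝ × X => φ p.1 p.2)
    (hφadd : ∀ s t x, φ (s + t) x = φ s (φ t x)) (hN : IsClosed N) (hL : IsClosed L)
    (hpos : ∀ x ∈ L, ∀ t ≥ (0 : ℝ), (∀ s ∈ Set.Icc 0 t, φ s x ∈ N) →
      ∀ s ∈ Set.Icc 0 t, φ s x ∈ L)
    (hexit : ∀ x ∈ N, ¬ (∀ t ≥ (0 : ℝ), φ t x ∈ N) →
      ∃ t ≥ (0 : ℝ), (∀ s ∈ Set.Icc 0 t, φ s x ∈ N) ∧ φ t x ∈ L)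
    {f : X → ℝ} (hf : Continuous f) (hfL : ∀ x ∈ L, f x = 0) :
    IsClosed (dampedSublevel φ N f) := by
  refine isOpen_compl_iff.1 (isOpen_iff_mem_nhds.2 fun x hx => ?_)
  by_cases hxN : x ∈ N
  swap
  · exact Filter.mem_of_superset (hN.isOpen_compl.mem_nhds hxN) fun y hy h => hy h.1
  simp only [dampedSublevel, Set.mem_compl_iff, Set.mem_ofPred_eq, not_and, not_forall,
    not_le] at hx
  obtain ⟨s, hs, hsN, hlt⟩ := hx hxN
  have havoid : ∀ r ∈ Set.Icc 0 s, φ r x ∉ L := fun r hr hrL => by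
    have := hfL _ (flow_mem_of_mem hφadd hpos hr.1 hr.2 hsN hrL)
    rw [this] at hlt
    norm_num at hlt
  have hc : Continuous fun y => Real.exp s * f (φ s y) :=
    continuous_const.mul (hf.comp (hφc.comp (continuous_const.prodMk continuous_id)))
  filter_upwards [eventually_forall_Icc_notMem hφc hL havoid,
    hc.continuousAt.eventually (lt_mem_nhds hlt)] with y hy hylt hmem
  exact absurd (hmem.2 s hs (mem_of_forall_notMem_exit hexit hmem.1 hy)) (not_le.2 hylt)

/-- A point of `N` whose orbit leaves `closure (N \ L)` and which satisfies the defining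
inequalities of `dampedSublevel` strictly is interior to it relative to `N`. -/
theorem eventually_mem_dampedSublevel (hφc : Continuous fun p : ℝ × X => φ p.1 p.2)
    (hφadd : ∀ s t x, φ (s + t) x = φ s (φ t x)) (hN : IsClosed N)
    (hpos : ∀ x ∈ L, ∀ t ≥ (0 : ℝ), (∀ s ∈ Set.Icc 0 t, φ s x ∈ N) →
      ∀ s ∈ Set.Icc 0 t, φ s x ∈ L)
    {f : X → ℝ} (hf : Continuous f) (hfL : ∀ x ∈ L, f x = 0) {x : X}
    (hleave : ∃ t ≥ (0 : ℝ), φ t x ∉ closure (N \ L))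
    (hlt : ∀ s ≥ (0 : ℝ), (∀ r ∈ Set.Icc 0 s, φ r x ∈ N) → Real.exp s * f (φ s x) < 1 / 2) :
    ∀ᶠ y in nhds x, y ∈ N → y ∈ dampedSublevel φ N f := by
  obtain ⟨T, hT, hTV⟩ := hleave
  have hcT : Continuous fun y => φ T y := hφc.comp (continuous_const.prodMk continuous_id)
  have hnear : ∀ᶠ y in nhds x, ∀ s ∈ Set.Icc 0 T,
      ¬ ((0 ≤ s ∧ ∀ r ∈ Set.Icc 0 s, φ r y ∈ N) ∧ 1 / 2 ≤ Real.exp s * f (φ s y)) := by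
    have hclosed : IsClosed {p : ℝ × X | (0 ≤ p.1 ∧ ∀ r ∈ Set.Icc 0 p.1, φ r p.2 ∈ N) ∧
        1 / 2 ≤ Real.exp p.1 * f (φ p.1 p.2)} :=
      (isClosed_setOf_forall_Icc_mem hφc hN).inter (isClosed_le continuous_const
        ((Real.continuous_exp.comp continuous_fst).mul (hf.comp hφc)))
    refine isCompact_Icc.eventually_forall_of_forall_eventually fun s _ => ?_
    exact (hclosed.isOpen_compl.preimage continuous_swap).mem_nhds (x := (x, s))
      fun h => absurd (hlt s h.1.1 h.1.2) (not_lt.2 h.2)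
  filter_upwards [hnear, hcT.continuousAt.eventually
    (isClosed_closure.isOpen_compl.mem_nhds hTV)] with y hy hyT hyN
  refine ⟨hyN, fun s hs hsN => ?_⟩
  rcases le_total s T with h | h
  · by_contra hgt
    exact hy s ⟨hs, h⟩ ⟨⟨hs, hsN⟩, (not_le.1 hgt).le⟩
  · have hTL : φ T y ∈ L := by
      by_contra hTL
      exact hyT (subset_closure ⟨hsN T ⟨hT, h⟩, hTL⟩)
    rw [hfL _ (flow_mem_of_mem hφadd hpos hT h hsN hTL)]
    norm_num

/-- The exit time map is continuous when `L` is closed and every point of `L` immediately enters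
the interior of `L ∪ Nᶜ`. -/
theorem continuous_tauPlus (hφc : Continuous fun p : ℝ × X => φ p.1 p.2)
    (hφadd : ∀ s t x, φ (s + t) x = φ s (φ t x)) (hN : IsClosed N) (hL : IsClosed L)
    (hexit : ∀ x ∈ N, ¬ (∀ t ≥ (0 : ℝ), φ t x ∈ N) →
      ∃ t ≥ (0 : ℝ), (∀ s ∈ Set.Icc 0 t, φ s x ∈ N) ∧ φ t x ∈ L)
    (henter : ∀ x ∈ L, ∀ t > (0 : ℝ), ∃ r ∈ Set.Icc 0 t,
      ∀ᶠ z in nhds (φ r x), z ∉ N \ L) :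
    Continuous (tauPlus φ N L) := by
  refine continuous_iff_continuousAt.2 fun x => tendsto_order.2 ⟨fun a ha => ?_, fun a ha => ?_⟩
  · obtain ⟨_, ⟨r, ⟨hr, hrN⟩, rfl⟩, har⟩ := lt_sSup_iff.1 ha
    filter_upwards [continuous_subtype_val.continuousAt.eventually
      (eventually_forall_Icc_notMem hφc hL fun s hs => (hrN s hs).2)] with y hy
    refine har.trans_le (le_sSup ⟨r, ⟨hr, fun s hs => ⟨?_, hy s hs⟩⟩, rfl⟩)
    exact mem_of_forall_notMem_exit hexit y.2 hy s hs
  · obtain ⟨b, hb, hba⟩ := ENNReal.lt_iff_exists_nnreal_btwn.1 ha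
    obtain ⟨c, hbc, hca⟩ := ENNReal.lt_iff_exists_nnreal_btwn.1 hba
    have hbc : (b : ℝ) < c := by exact_mod_cast hbc
    suffices H : ∃ u ∈ Set.Icc (0 : ℝ) c, ∀ᶠ z in nhds (φ u (x : X)), z ∉ N \ L by
      obtain ⟨u, hu, hev⟩ := H
      have hc : Continuous fun y : N => φ u (y : X) :=
        hφc.comp (continuous_const.prodMk continuous_subtype_val)
      filter_upwards [hc.continuousAt.eventually hev] with y hy
      refine lt_of_le_of_lt (sSup_le ?_) hca
      rintro _ ⟨r, ⟨_, hrN⟩, rfl⟩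
      rw [← ENNReal.ofReal_coe_nnreal]
      refine ENNReal.ofReal_le_ofReal ?_
      by_contra hcr
      exact hy (hrN u ⟨hu.1, hu.2.trans (not_le.1 hcr).le⟩)
    have hbS : ¬ ∀ s ∈ Set.Icc (0 : ℝ) b, φ s (x : X) ∈ N \ L := fun H =>
      hb.not_ge (le_sSup ⟨b, ⟨b.2, H⟩, ENNReal.ofReal_coe_nnreal⟩)
    push Not at hbS
    obtain ⟨s, hs, hsN⟩ := hbS
    by_cases hmem : φ s (x : X) ∈ N
    · obtain ⟨r, hr, hev⟩ := henter _ (by_contra fun h => hsN ⟨hmem, h⟩) (c - b)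
        (sub_pos.2 hbc)
      rw [← hφadd] at hev
      exact ⟨r + s, ⟨add_nonneg hr.1 hs.1, by linarith [hr.2, hs.2]⟩, hev⟩
    · exact ⟨s, ⟨hs.1, hs.2.trans hbc.le⟩,
        Filter.mem_of_superset (hN.isOpen_compl.mem_nhds hmem) fun z hz h => hz h.1⟩

end IndexPair

theorem stmt8 {X : Type*} [MetricSpace X]
    (φ : ℝ → X → X)
    (hφc : Continuous fun p : ℝ × X => φ p.1 p.2)
    (hφ0 : ∀ x, φ 0 x = x)
    (hφadd : ∀ s t x, φ (s + t) x = φ s (φ t x))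
    (I : Set X)
    (N L : Set X) (hN : IsClosed N) (hL : IsClosed L) (hLN : L ⊆ N)
    -- (i), (ii) : (N, L) is an index pair …
    (hpos : ∀ x ∈ L, ∀ t ≥ (0 : ℝ), (∀ s ∈ Set.Icc 0 t, φ s x ∈ N) →
      ∀ s ∈ Set.Icc 0 t, φ s x ∈ L)
    (hexit : ∀ x ∈ N, ¬ (∀ t ≥ (0 : ℝ), φ t x ∈ N) →
      ∃ t ≥ (0 : ℝ), (∀ s ∈ Set.Icc 0 t, φ s x ∈ N) ∧ φ t x ∈ L)
    -- … for the isolated invariant set I: cl(N − L) is an isolating neighborhood for I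
    (hI : {x ∈ closure (N \ L) | ∀ t : ℝ, φ t x ∈ closure (N \ L)} = I)
    (hIint : I ⊆ interior (closure (N \ L)))
    -- (N, L) is weakly regular
    (hwr : ∀ x ∈ L, ∃ t ≥ (0 : ℝ), φ t x ∉ closure (N \ L)) :
    -- there is a closed L ⊆ L' ⊆ N such that (N, L') is a regular index pair for I
    ∃ L' : Set X, IsClosed L' ∧ L ⊆ L' ∧ L' ⊆ N ∧
      (∀ x ∈ L', ∀ t ≥ (0 : ℝ), (∀ s ∈ Set.Icc 0 t, φ s x ∈ N) →
        ∀ s ∈ Set.Icc 0 t, φ s x ∈ L') ∧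
      (∀ x ∈ N, ¬ (∀ t ≥ (0 : ℝ), φ t x ∈ N) →
        ∃ t ≥ (0 : ℝ), (∀ s ∈ Set.Icc 0 t, φ s x ∈ N) ∧ φ t x ∈ L') ∧
      {x ∈ closure (N \ L') | ∀ t : ℝ, φ t x ∈ closure (N \ L')} = I ∧
      I ⊆ interior (closure (N \ L')) ∧
      Continuous (tauPlus φ N L') := by
  set U : Set X := {x | ∃ t ≥ (0 : ℝ), φ t x ∉ closure (N \ L)} with hU
  have hUopen : IsOpen U := by
    have : U = ⋃ t ∈ Set.Ici (0 : ℝ), (fun y => φ t y) ⁻¹' (closure (N \ L))ᶜ := by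
      ext x
      simp [hU]
    rw [this]
    exact isOpen_biUnion fun t _ => isClosed_closure.isOpen_compl.preimage
      (hφc.comp (continuous_const.prodMk continuous_id))
  have hLU : Disjoint L Uᶜ := Set.disjoint_left.2 fun x hx hxU => hxU (hwr x hx)
  obtain ⟨f, hfL, hfU, -⟩ := exists_continuous_zero_one_of_isClosed hL hUopen.isClosed_compl hLU
  have hL'U : dampedSublevel φ N f ⊆ U := fun x hx => by
    by_contra hxU
    have h := hx.2 0 le_rfl fun r hr => by
      rw [le_antisymm hr.2 hr.1, hφ0]
      exact hx.1
    rw [hφ0, hfU hxU] at h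
    norm_num at h
  have hLL' : L ⊆ dampedSublevel φ N f := fun x hx => ⟨hLN hx, fun s hs hsN => by
    rw [hfL (hpos x hx s hs hsN s ⟨hs, le_rfl⟩)]
    norm_num⟩
  have hIU : ∀ x ∈ I, x ∉ U := by
    rw [← hI]
    rintro x ⟨_, hx⟩ ⟨t, _, ht⟩
    exact ht (hx t)
  have hVN : closure (N \ L) ⊆ N := closure_minimal Set.sdiff_subset hN
  have hclosed := isClosed_dampedSublevel hφc hφadd hN hL hpos hexit f.continuous hfL
  have hIint' : I ⊆ interior (closure (N \ dampedSublevel φ N f)) := fun x hx =>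
    mem_interior_iff_mem_nhds.2 <| by
      filter_upwards [mem_interior_iff_mem_nhds.1 (hIint hx),
        hclosed.isOpen_compl.mem_nhds fun h => hIU x hx (hL'U h)] with y hy hy'
      exact subset_closure ⟨hVN hy, hy'⟩
  have hexit' : ∀ x ∈ N, ¬ (∀ t ≥ (0 : ℝ), φ t x ∈ N) →
      ∃ t ≥ (0 : ℝ), (∀ s ∈ Set.Icc 0 t, φ s x ∈ N) ∧ φ t x ∈ dampedSublevel φ N f :=
    fun x hx h => by
      obtain ⟨t, ht, htN, htL⟩ := hexit x hx h
      exact ⟨t, ht, htN, hLL' htL⟩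
  refine ⟨dampedSublevel φ N f, hclosed, hLL', fun x hx => hx.1,
    fun x hx t _ hN => dampedSublevel_positivelyInvariant hφadd hx hN, hexit', ?_, hIint', ?_⟩
  · refine Set.Subset.antisymm (fun x hx => ?_) fun x hx => ?_
    · have hmono : closure (N \ dampedSublevel φ N f) ⊆ closure (N \ L) :=
        closure_mono (Set.sdiff_subset_sdiff_right hLL')
      rw [← hI]
      exact ⟨hmono hx.1, fun t => hmono (hx.2 t)⟩
    · have hinv : ∀ t, φ t x ∈ I := fun t => by
        rw [← hI] at hx ⊢
        exact ⟨hx.2 t, fun s => by rw [← hφadd]; exact hx.2 (s + t)⟩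
      exact ⟨interior_subset (hIint' hx), fun t => interior_subset (hIint' (hinv t))⟩
  · refine continuous_tauPlus hφc hφadd hN hclosed hexit' fun x hx t ht => ?_
    by_cases hstay : ∀ s ∈ Set.Icc 0 t, φ s x ∈ N
    · refine ⟨t, ⟨ht.le, le_rfl⟩, ?_⟩
      have hmem := dampedSublevel_positivelyInvariant hφadd hx hstay t ⟨ht.le, le_rfl⟩
      filter_upwards [eventually_mem_dampedSublevel hφc hφadd hN hpos f.continuous hfL
        (hL'U hmem) fun s hs hsN => by
          have h := dampedSublevel_flow hφadd hx ht.le hstay hs hsN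
          have : Real.exp (-t) < 1 := Real.exp_lt_one_iff.2 (by linarith)
          linarith] with z hz hz'
      exact hz'.2 (hz hz'.1)
    · push Not at hstay
      obtain ⟨r, hr, hrN⟩ := hstay
      exact ⟨r, hr, Filter.mem_of_superset (hN.isOpen_compl.mem_nhds hrN) fun z hz h => hz h.1⟩
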